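/- Let T ∈ ℕ₊, λ ∈ (0,1), λ̂ ∈ [λ,1), σ₁, σ₂ > 0, B̄ ≥ 0, v̄ ≥ 0, and suppose x : ℕ → ℝⁿ, A : ℕ → ℝ^{n×n}, B : ℕ → ℝ^{n×m}, ṽ : ℕ → ℝᵐ, K : ℕ → ℝ^{m×n}, and symmetric positive definite P : ℕ → ℝ^{n×n} satisfy hypotheses (i)–(v): x(t+1) = A(t)x(t) + B(t)(K_{⌊t/T⌋} x(t) + ṽ(t)); ‖ṽ(t)‖ ≤ v̄ and ‖B(t)‖ ≤ B̄ for all t; (A(t) + B(t)K_i)ᵀ P_i (A(t) + B(t)K_i) ⪯ λ P_i for every i ∈ ℕ and every t with iT ≤ t < (i+1)T; σ₁ I_n ⪯ P_i ⪯ σ₂ I_n for all i; and P_{i+1} ⪯ (λ̂/λ)^T P_i for all i. Define q(t) := (λ̂/λ)^{(t − ⌊t/T⌋·T)/2} · ‖P_{⌊t/T⌋}^{1/2} x(t)‖. Then for all t ∈ ℕ: (a) √σ₁ · ‖x(t)‖ ≤ q(t) ≤ (λ̂/λ)^{(T−1)/2} · √σ₂ · ‖x(t)‖, and (b) q(t+1)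 ≤ √λ̂ · q(t) + (λ̂/λ)^{T/2} · √σ₂ · B̄ · v̄. -/

import Mathlib

open Matrix
open scoped Matrix.Norms.L2Operator MatrixOrder

lemma le_of_sq_le_sq_aux (a b : ℝ) (hb : 0 ≤ b) (h : a ^ 2 ≤ b ^ 2) : a ≤ b :=
  abs_le_of_sq_le_sq' h hb |>.2

lemma W_sq {n : ℕ} (S : Matrix (Fin n) (Fin n) ℝ) (hS : S.PosSemidef)
    (y : EuclideanSpace ℝ (Fin n)) :
    ‖toEuclideanLin (CFC.sqrt S) y‖ ^ 2 = y.ofLp ⬝ᵥ (S *ᵥ y.ofLp) := by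
  have h1 : CFC.sqrt S * CFC.sqrt S = S := CFC.sqrt_mul_sqrt_self S hS.nonneg
  have h2 : (CFC.sqrt S)ᵀ = CFC.sqrt S := by
    have := (Matrix.nonneg_iff_posSemidef.mp (CFC.sqrt_nonneg S)).isHermitian
    rwa [Matrix.IsHermitian, Matrix.conjTranspose_eq_transpose_of_trivial] at this
  have h3 : ‖toEuclideanLin (CFC.sqrt S) y‖ ^ 2
      = (CFC.sqrt S *ᵥ y.ofLp) ⬝ᵥ (CFC.sqrt S *ᵥ y.ofLp) := by
    rw [EuclideanSpace.real_norm_sq_eq]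
    simp [dotProduct, Matrix.ofLp_toLpLin, pow_two]
  rw [h3, Matrix.dotProduct_mulVec, ← Matrix.mulVec_transpose, h2, Matrix.mulVec_mulVec, h1,
    dotProduct_comm]

lemma norm_sq_dot {n : ℕ} (y : EuclideanSpace ℝ (Fin n)) : ‖y‖ ^ 2 = y.ofLp ⬝ᵥ y.ofLp := by
  rw [EuclideanSpace.real_norm_sq_eq]
  simp [dotProduct, pow_two]

lemma psd_dot {n : ℕ} {S : Matrix (Fin n) (Fin n) ℝ} (h : S.PosSemidef) (y : Fin n → ℝ) :
    0 ≤ y ⬝ᵥ (S *ᵥ y) := by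
  simpa using h.dotProduct_mulVec_nonneg y

lemma W_le {n : ℕ} (S Q M : Matrix (Fin n) (Fin n) ℝ) (hS : S.PosSemidef) (hQ : Q.PosSemidef)
    (c : ℝ) (hc : 0 ≤ c) (h : (c • S - Mᵀ * Q * M).PosSemidef) (y : EuclideanSpace ℝ (Fin n)) :
    ‖toEuclideanLin (CFC.sqrt Q) (toEuclideanLin M y)‖
      ≤ Real.sqrt c * ‖toEuclideanLin (CFC.sqrt S) y‖ := by
  apply le_of_sq_le_sq_aux _ _ (by positivity)
  rw [mul_pow, Real.sq_sqrt hc, W_sq S hS, W_sq Q hQ]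
  have h1 := psd_dot h y.ofLp
  rw [Matrix.sub_mulVec, dotProduct_sub, Matrix.smul_mulVec, dotProduct_smul, smul_eq_mul,
    ← Matrix.mulVec_mulVec, ← Matrix.mulVec_mulVec, Matrix.dotProduct_mulVec _ Mᵀ,
    Matrix.vecMul_transpose] at h1
  rw [Matrix.ofLp_toLpLin, Matrix.toLin'_apply]
  linarith

lemma W_upper {n : ℕ} (S : Matrix (Fin n) (Fin n) ℝ) (hS : S.PosSemidef)
    (c : ℝ) (hc : 0 ≤ c) (h : (c • (1 : Matrix (Fin n) (Fin n) ℝ) - S).PosSemidef)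
    (y : EuclideanSpace ℝ (Fin n)) :
    ‖toEuclideanLin (CFC.sqrt S) y‖ ≤ Real.sqrt c * ‖y‖ := by
  apply le_of_sq_le_sq_aux _ _ (by positivity)
  rw [mul_pow, Real.sq_sqrt hc, W_sq S hS, norm_sq_dot]
  have h1 := psd_dot h y.ofLp
  rw [Matrix.sub_mulVec, dotProduct_sub, Matrix.smul_mulVec, dotProduct_smul, smul_eq_mul,
    Matrix.one_mulVec] at h1
  linarith

lemma W_lower {n : ℕ} (S : Matrix (Fin n) (Fin n) ℝ) (hS : S.PosSemidef)
    (c : ℝ) (hc : 0 ≤ c) (h : (S - c • (1 : Matrix (Fin n) (Fin n) ℝ)).PosSemidef)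
    (y : EuclideanSpace ℝ (Fin n)) :
    Real.sqrt c * ‖y‖ ≤ ‖toEuclideanLin (CFC.sqrt S) y‖ := by
  apply le_of_sq_le_sq_aux _ _ (by positivity)
  rw [mul_pow, Real.sq_sqrt hc, W_sq S hS, norm_sq_dot]
  have h1 := psd_dot h y.ofLp
  rw [Matrix.sub_mulVec, dotProduct_sub, Matrix.smul_mulVec, dotProduct_smul, smul_eq_mul,
    Matrix.one_mulVec] at h1
  linarith

/-- claims (26) and (27) in the proof of Theorem 1: the sandwich
bounds and the one-step contraction-plus-offset recursion for the auxiliary function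
`q(t) = (λ̂/λ)^{(t − ⌊t/T⌋T)/2} ‖P_{⌊t/T⌋}^{1/2} x(t)‖`. Vector norms are Euclidean,
matrix norms spectral, and `P^{1/2}` is the positive semidefinite square root. -/
theorem q_bounds (n m : ℕ) (hn : 0 < n) (hm : 0 < m) (T : ℕ) (hT : 0 < T)
    (lam lamhat σ₁ σ₂ Bbar vbar : ℝ)
    (hlam0 : 0 < lam) (hlam1 : lam < 1)
    (hlamhat_ge : lam ≤ lamhat) (hlamhat_lt : lamhat < 1)
    (hσ₁ : 0 < σ₁) (hσ₂ : 0 < σ₂) (hBbar : 0 ≤ Bbar) (hvbar : 0 ≤ vbar)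
    (x : ℕ → EuclideanSpace ℝ (Fin n))
    (A : ℕ → Matrix (Fin n) (Fin n) ℝ) (B : ℕ → Matrix (Fin n) (Fin m) ℝ)
    (v : ℕ → EuclideanSpace ℝ (Fin m))
    (K : ℕ → Matrix (Fin m) (Fin n) ℝ) (P : ℕ → Matrix (Fin n) (Fin n) ℝ)
    (hPd : ∀ i, (P i).PosDef)
    -- (i) closed-loop dynamics
    (hdyn : ∀ t, x (t + 1) = toEuclideanLin (A t) (x t)
      + toEuclideanLin (B t) (toEuclideanLin (K (t / T)) (x t) + v t))
    -- (ii) uniform bounds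
    (hv : ∀ t, ‖v t‖ ≤ vbar) (hB : ∀ t, ‖B t‖ ≤ Bbar)
    -- (iii) Lyapunov decrease on each interval
    (hLyap : ∀ i t, i * T ≤ t → t < (i + 1) * T →
      (lam • P i - (A t + B t * K i)ᵀ * P i * (A t + B t * K i)).PosSemidef)
    -- (iv) sandwich condition
    (hsand₁ : ∀ i, (P i - σ₁ • (1 : Matrix (Fin n) (Fin n) ℝ)).PosSemidef)
    (hsand₂ : ∀ i, (σ₂ • (1 : Matrix (Fin n) (Fin n) ℝ) - P i).PosSemidef)
    -- (v) condition at gain updates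
    (hswitch : ∀ i, (((lamhat / lam) ^ T) • P i - P (i + 1)).PosSemidef)
    -- the auxiliary function q
    (q : ℕ → ℝ)
    (hq : ∀ t, q t = (lamhat / lam) ^ (((t - t / T * T : ℕ) : ℝ) / 2)
      * ‖toEuclideanLin (CFC.sqrt (P (t / T))) (x t)‖) :
    ∀ t : ℕ,
      (Real.sqrt σ₁ * ‖x t‖ ≤ q t ∧
        q t ≤ (lamhat / lam) ^ (((T : ℝ) - 1) / 2) * Real.sqrt σ₂ * ‖x t‖) ∧
      q (t + 1) ≤ Real.sqrt lamhat * q t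
        + (lamhat / lam) ^ ((T : ℝ) / 2) * Real.sqrt σ₂ * Bbar * vbar := by
  intro t
  have hρ1 : 1 ≤ lamhat / lam := (one_le_div hlam0).mpr hlamhat_ge
  have hρ0 : 0 < lamhat / lam := by linarith
  set ρ := lamhat / lam with hρ
  have hPs : ∀ i, (P i).PosSemidef := fun i => (hPd i).posSemidef
  set i := t / T with hi
  have hdm : i * T ≤ t := Nat.div_mul_le_self t T
  have hlt : t < (i + 1) * T := by
    rw [add_mul, one_mul]; exact Nat.lt_div_mul_add hT
  obtain ⟨r, hr⟩ : ∃ r, t = i * T + r := ⟨t - i * T, by omega⟩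
  have hrT : r < T := by rw [add_mul, one_mul] at hlt; omega
  have hsub : t - i * T = r := by omega
  have hqt : q t = ρ ^ ((r : ℝ) / 2) * ‖toEuclideanLin (CFC.sqrt (P i)) (x t)‖ := by
    rw [hq t, ← hi, hsub]
  have hrT' : (r : ℝ) + 1 ≤ T := by exact_mod_cast hrT
  have hlow := W_lower (P i) (hPs i) σ₁ hσ₁.le (hsand₁ i) (x t)
  have hup := W_upper (P i) (hPs i) σ₂ hσ₂.le (hsand₂ i) (x t)
  have hW0 := norm_nonneg (toEuclideanLin (CFC.sqrt (P i)) (x t))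
  refine ⟨⟨?_, ?_⟩, ?_⟩
  · rw [hqt]
    have : 1 ≤ ρ ^ ((r : ℝ) / 2) := Real.one_le_rpow hρ1 (by positivity)
    nlinarith
  · rw [hqt, mul_assoc]
    have : ρ ^ ((r : ℝ) / 2) ≤ ρ ^ (((T : ℝ) - 1) / 2) :=
      Real.rpow_le_rpow_of_exponent_le hρ1 (by linarith)
    exact mul_le_mul this hup hW0 (by positivity)
  · have hstep : q (t + 1) ≤ ρ ^ (((r : ℝ) + 1) / 2)
        * ‖toEuclideanLin (CFC.sqrt (P i)) (x (t + 1))‖ := by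
      rcases Nat.lt_or_ge (r + 1) T with h | h
      · have hd : (t + 1) / T = i := by
          apply Nat.div_eq_of_lt_le
          · omega
          · rw [add_mul, one_mul]; omega
        rw [hq (t + 1), hd, show t + 1 - i * T = r + 1 by omega]
        push_cast
        exact le_rfl
      · have hrE : r + 1 = T := by omega
        have ht : t + 1 = (i + 1) * T := by rw [add_mul, one_mul]; omega
        have hd : (t + 1) / T = i + 1 := by rw [ht, Nat.mul_div_cancel _ hT]
        have hrE' : (r : ℝ) + 1 = T := by exact_mod_cast hrE
        have h3 := W_le (P i) (P (i + 1)) 1 (hPs i) (hPs (i + 1)) (ρ ^ T) (by positivity)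
          (by simpa using hswitch i) (x (t + 1))
        have h4 : Real.sqrt (ρ ^ T) = ρ ^ ((T : ℝ) / 2) := by
          rw [Real.sqrt_eq_rpow, ← Real.rpow_natCast, ← Real.rpow_mul hρ0.le]
          congr 1; ring
        have h5 : toEuclideanLin (1 : Matrix (Fin n) (Fin n) ℝ) (x (t + 1)) = x (t + 1) := by
          simp
        rw [h4, h5] at h3
        rw [hq (t + 1), hd, show t + 1 - (i + 1) * T = 0 by omega, hrE']
        simpa using h3
    have hx : x (t + 1) = toEuclideanLin (A t + B t * K i) (x t)
        + toEuclideanLin (B t) (v t) := by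
      rw [hdyn t, ← hi]
      ext j
      simp [Matrix.ofLp_toLpLin, Matrix.add_mulVec, Matrix.mulVec_add, Matrix.mulVec_mulVec]
      ring
    have hBv : ‖toEuclideanLin (B t) (v t)‖ ≤ Bbar * vbar := by
      have h1 := Matrix.l2_opNorm_mulVec (B t) (v t)
      exact le_trans h1 (mul_le_mul (hB t) (hv t) (norm_nonneg _) hBbar)
    have h1 := W_le (P i) (P i) (A t + B t * K i) (hPs i) (hPs i) lam hlam0.le
      (hLyap i t hdm hlt) (x t)
    have h2 := W_upper (P i) (hPs i) σ₂ hσ₂.le (hsand₂ i) (toEuclideanLin (B t) (v t))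
    have h2' := h2.trans (mul_le_mul_of_nonneg_left hBv (Real.sqrt_nonneg σ₂))
    have h6 : ‖toEuclideanLin (CFC.sqrt (P i)) (x (t + 1))‖
        ≤ Real.sqrt lam * ‖toEuclideanLin (CFC.sqrt (P i)) (x t)‖
          + Real.sqrt σ₂ * (Bbar * vbar) := by
      rw [hx, map_add]
      exact (norm_add_le _ _).trans (add_le_add h1 h2')
    have h7 : ρ ^ (((r : ℝ) + 1) / 2) * Real.sqrt lam = Real.sqrt lamhat * ρ ^ ((r : ℝ) / 2) := by
      have e : lamhat = ρ * lam := by rw [hρ]; field_simp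
      rw [e, Real.sqrt_mul hρ0.le, add_div, Real.rpow_add hρ0, ← Real.sqrt_eq_rpow]
      ring
    have h8 : ρ ^ (((r : ℝ) + 1) / 2) ≤ ρ ^ ((T : ℝ) / 2) :=
      Real.rpow_le_rpow_of_exponent_le hρ1 (by linarith)
    calc q (t + 1) ≤ _ := hstep
      _ ≤ ρ ^ (((r : ℝ) + 1) / 2) * (Real.sqrt lam * ‖toEuclideanLin (CFC.sqrt (P i)) (x t)‖
          + Real.sqrt σ₂ * (Bbar * vbar)) := mul_le_mul_of_nonneg_left h6 (by positivity)
      _ = Real.sqrt lamhat * q t + ρ ^ (((r : ℝ) + 1) / 2) * (Real.sqrt σ₂ * (Bbar * vbar)) := by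
          rw [hqt, mul_add, ← mul_assoc, h7, mul_assoc]
      _ ≤ Real.sqrt lamhat * q t + ρ ^ ((T : ℝ) / 2) * (Real.sqrt σ₂ * (Bbar * vbar)) := by
          gcongr
      _ = _ := by ring
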